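/- The transformation 𝒯 carries null curves into null curves: Let U ⊆ ℂ be open and let F = (F₁,F₂,F₃) : U → ℂ³ be holomorphic with F₃(ζ) ≠ 0 and F'(ζ) ∈ 𝔄∖{0} for every ζ ∈ U, where 𝔄 = {(z₁,z₂,z₃) ∈ ℂ³ : z₁² + z₂² + z₃² = 0}. Define G : U → Matrix₂ₓ₂(ℂ) by G = 𝒯 ∘ F, where 𝒯(z₁,z₂,z₃) = (1/z₃) · [[1, z₁ + iz₂], [z₁ − iz₂, z₁² + z₂² + z₃²]]. Then G is holomorphic (each entry is holomorphic on U), det(G(ζ)) = 1 for every ζ ∈ U, and the entrywise complex derivative G'(ζ) is, for every ζ ∈ U, a nonzero 2×2 matrix with det(G'(ζ)) = 0; that is, G is a null holomorphic curve in SL₂(ℂ). -/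

import Mathlib

open Set

noncomputable section

/-- `ℂ³` with its Euclidean (Hermitian) metric. -/
abbrev C3 : Type := EuclideanSpace ℂ (Fin 3)

/-- The space of `2 × 2` complex matrices, `≅ ℂ⁴`. -/
abbrev M2C : Type := Matrix (Fin 2) (Fin 2) ℂ

/-- The null quadric `𝔄 = {z ∈ ℂ³ : z₁² + z₂² + z₃² = 0}`. -/
def nullQuadric : Set C3 := {z | z 0 ^ 2 + z 1 ^ 2 + z 2 ^ 2 = 0}

/-- The transformation `𝒯(z₁,z₂,z₃) = z₃⁻¹ · [[1, z₁+iz₂], [z₁−iz₂, z₁²+z₂²+z₃²]]`. -/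
def TMap (z : C3) : M2C :=
  (z 2)⁻¹ • !![1, z 0 + Complex.I * z 1;
               z 0 - Complex.I * z 1, z 0 ^ 2 + z 1 ^ 2 + z 2 ^ 2]

/-- The entrywise complex derivative of a matrix-valued map `ℂ → Matrix₂ₓ₂(ℂ)`. -/
def entryDeriv (G : ℂ → M2C) (ζ : ℂ) : M2C :=
  Matrix.of fun i j => deriv (fun w => G w i j) ζ

theorem TMap_apply (z : C3) :
    TMap z = !![(z 2)⁻¹, (z 2)⁻¹ * (z 0 + Complex.I * z 1);
      (z 2)⁻¹ * (z 0 - Complex.I * z 1), (z 2)⁻¹ * (z 0 ^ 2 + z 1 ^ 2 + z 2 ^ 2)] := by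
  ext i j
  fin_cases i <;> fin_cases j <;> simp [TMap]

theorem det_TMap {z : C3} (hz : z 2 ≠ 0) : (TMap z).det = 1 := by
  rw [TMap_apply, Matrix.det_fin_two_of]
  field_simp
  linear_combination z 1 ^ 2 * Complex.I_sq

/-- The differential of `TMap` at `z` applied to `v`. -/
def TMapDifferential (z v : C3) : M2C :=
  !![-v 2 / z 2 ^ 2,
      -v 2 / z 2 ^ 2 * (z 0 + Complex.I * z 1) + (z 2)⁻¹ * (v 0 + Complex.I * v 1);
    -v 2 / z 2 ^ 2 * (z 0 - Complex.I * z 1) + (z 2)⁻¹ * (v 0 - Complex.I * v 1),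
      -v 2 / z 2 ^ 2 * (z 0 ^ 2 + z 1 ^ 2 + z 2 ^ 2) +
        (z 2)⁻¹ * (2 * z 0 * v 0 + 2 * z 1 * v 1 + 2 * z 2 * v 2)]

theorem hasDerivAt_TMap_comp {F : ℂ → C3} {v : C3} {ζ : ℂ} (hF : HasDerivAt F v ζ)
    (hζ : F ζ 2 ≠ 0) (i j : Fin 2) :
    HasDerivAt (fun w => TMap (F w) i j) (TMapDifferential (F ζ) v i j) ζ := by
  have hc (k : Fin 3) : HasDerivAt (fun w => F w k) (v k) ζ :=
    (EuclideanSpace.proj (𝕜 := ℂ) k).hasFDerivAt.comp_hasDerivAt ζ hF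
  have hinv : HasDerivAt (fun w => (F w 2)⁻¹) (-v 2 / F ζ 2 ^ 2) ζ := (hc 2).fun_inv hζ
  have hI := (hc 1).const_mul Complex.I
  have hsq (k : Fin 3) : HasDerivAt (fun w => F w k ^ 2) (2 * F ζ k * v k) ζ := by
    simpa using (hc k).fun_pow 2
  simp only [TMap_apply]
  fin_cases i <;> fin_cases j
  · exact hinv
  · exact hinv.mul ((hc 0).add hI)
  · exact hinv.mul ((hc 0).sub hI)
  · exact hinv.mul (((hsq 0).add (hsq 1)).add (hsq 2))

theorem det_TMapDifferential {z v : C3} (hz : z 2 ≠ 0) (hv : v ∈ nullQuadric) :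
    (TMapDifferential z v).det = 0 := by
  have hv' : v 0 ^ 2 + v 1 ^ 2 + v 2 ^ 2 = 0 := hv
  rw [TMapDifferential, Matrix.det_fin_two_of]
  field_simp
  linear_combination -(z 2) ^ 2 * hv' +
    (v 1 * z 2 - v 2 * z 1) ^ 2 * Complex.I_sq

theorem TMapDifferential_ne_zero {z v : C3} (hz : z 2 ≠ 0) (hv : v ≠ 0) :
    TMapDifferential z v ≠ 0 := by
  intro h
  have h2 : v 2 = 0 := by
    simpa [TMapDifferential, hz] using congrFun (congrFun h 0) 0
  have hp : v 0 + Complex.I * v 1 = 0 := by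
    simpa [TMapDifferential, hz, h2] using congrFun (congrFun h 0) 1
  have hq : v 0 - Complex.I * v 1 = 0 := by
    simpa [TMapDifferential, hz, h2] using congrFun (congrFun h 1) 0
  have h0 : v 0 = 0 := by linear_combination (hp + hq) / 2
  have h1 : v 1 = 0 := by
    simpa [h0] using hp
  apply hv
  ext k
  fin_cases k
  exacts [h0, h1, h2]

/-- **Martín–Umehara–Yamada**: the transformation `𝒯` carries null holomorphic curves in
`ℂ³ ∖ {z₃ = 0}` to null holomorphic curves in `SL₂(ℂ)`. -/
theorem TMap_maps_null_curves_to_null_curves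
    (U : Set ℂ) (hU : IsOpen U)
    (F : ℂ → C3) (hF : DifferentiableOn ℂ F U)
    (hF3 : ∀ ζ ∈ U, F ζ 2 ≠ 0)
    (hnull : ∀ ζ ∈ U, deriv F ζ ∈ nullQuadric \ {0}) :
    (∀ i j : Fin 2, DifferentiableOn ℂ (fun ζ => TMap (F ζ) i j) U) ∧
    (∀ ζ ∈ U, (TMap (F ζ)).det = 1) ∧
    (∀ ζ ∈ U, entryDeriv (fun w => TMap (F w)) ζ ≠ 0 ∧
      (entryDeriv (fun w => TMap (F w)) ζ).det = 0) := by
  have hderiv {ζ : ℂ} (hζ : ζ ∈ U) (i j : Fin 2) :=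
    hasDerivAt_TMap_comp (hF.differentiableAt (hU.mem_nhds hζ)).hasDerivAt (hF3 ζ hζ) i j
  refine ⟨fun i j ζ hζ => (hderiv hζ i j).differentiableAt.differentiableWithinAt,
    fun ζ hζ => det_TMap (hF3 ζ hζ), fun ζ hζ => ?_⟩
  have hG : entryDeriv (fun w => TMap (F w)) ζ = TMapDifferential (F ζ) (deriv F ζ) := by
    ext i j
    exact (hderiv hζ i j).deriv
  rw [hG]
  exact ⟨TMapDifferential_ne_zero (hF3 ζ hζ) (hnull ζ hζ).2,
    det_TMapDifferential (hF3 ζ hζ) (hnull ζ hζ).1⟩
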